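/- Let R̂^⊥ denote the orthogonal complement of R̂ = ⋂_{λ∈Λ} ker(r_λ|L_5) within L_5 (the span of the projections n_λ of the coefficient vectors of the r_λ to L_5). Then R̂^⊥ is an η_5-invariant 5-dimensional subspace of L_5, the restriction of η_5 to R̂^⊥ is irreducible, and Tr(η_5(τ)|R̂^⊥) = −1 for every transposition τ ∈ S_5 (so the character of η_5|R̂^⊥ is the prime character χ^{2²1} of S_5). -/

import Mathlib

open Equiv

/-- XOR on `Fin 4` (the Klein group structure on vertices of a tetrahedron). -/
def xor4 (a b : Fin 4) : Fin 4 :=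
  ⟨(a.val ^^^ b.val) % 4, Nat.mod_lt _ (by norm_num)⟩

/-- The underlying function of the cross-ratio homomorphism `φ : S₄ → S₃`:
a permutation of the vertices `{0,1,2,3}` of a tetrahedron induces a permutation of the
three partitions of the vertex set into two pairs of opposite edges; the partition pairing
`0` with `j+1` is indexed by `j : Fin 3`. -/
def phiFun (π : Perm (Fin 4)) (j : Fin 3) : Fin 3 :=
  ⟨(xor4 (π 0) (π ⟨j.val + 1, by omega⟩)).val - 1, by
    have h := (xor4 (π 0) (π ⟨j.val + 1, by omega⟩)).isLt
    omega⟩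

lemma phiFun_leftInv : ∀ (π : Perm (Fin 4)) (j : Fin 3), phiFun π⁻¹ (phiFun π j) = j := by
  decide

/-- The cross-ratio homomorphism `φ : S₄ → S₃`. -/
def phi (π : Perm (Fin 4)) : Perm (Fin 3) where
  toFun := phiFun π
  invFun := phiFun π⁻¹
  left_inv := phiFun_leftInv π
  right_inv := fun j => by simpa using phiFun_leftInv π⁻¹ j

/-- Restriction of a permutation `π` to a bijection between the complement of `{i}`
and the complement of `{π i}`. -/
def restrictPerm {k : ℕ} (π : Perm (Fin k)) (i : Fin k) :
    {x : Fin k // x ≠ i} ≃ {x : Fin k // x ≠ π i} where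
  toFun x := ⟨π x.1, fun h => x.2 (π.injective h)⟩
  invFun y := ⟨π.symm y.1, fun h => y.2 (by simpa using congrArg π h)⟩
  left_inv x := Subtype.ext (π.symm_apply_apply x.1)
  right_inv y := Subtype.ext (π.apply_symm_apply y.1)

/-- The induced permutation `π_i ∈ S_k` of `π ∈ S_{k+1}`: the restriction of `π` to the
complement of `{i}`, reindexed via the order preserving identifications with `Fin k`. -/
def inducedPerm {k : ℕ} (π : Perm (Fin (k + 1))) (i : Fin (k + 1)) : Perm (Fin k) :=
  ((finSuccAboveEquiv i).trans ((restrictPerm π i).trans (finSuccAboveEquiv (π i)).symm))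

/-- `η₄ : S₄ → Aut(V⁴)`, `V⁴ = ℝ³`: the signed cross-ratio representation,
`η₄(π)(e_j) = sign(π) e_{φ(π) j}`. -/
noncomputable def eta4fun (π : Equiv.Perm (Fin 4)) (v : Fin 3 → ℝ) : Fin 3 → ℝ :=
  fun j => ((Equiv.Perm.sign π : ℤ) : ℝ) * v ((phi π)⁻¹ j)

/-- The canonical representation `η₅ : S₅ → Aut(V⁵)` on the space `V⁵` of `5 × 3`
real matrices: `η₅(π)(e_i ⊗ u) = e_{π(i)} ⊗ η₄(π_i)(u)`. -/
noncomputable def eta5fun (π : Equiv.Perm (Fin 5)) (v : Fin 5 → Fin 3 → ℝ) :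
    Fin 5 → Fin 3 → ℝ :=
  fun i => eta4fun (inducedPerm π (π⁻¹ i)) (v (π⁻¹ i))

/-- `η₅(π)` as a linear endomorphism of `V⁵`. -/
noncomputable def eta5lin (π : Equiv.Perm (Fin 5)) :
    (Fin 5 → Fin 3 → ℝ) →ₗ[ℝ] (Fin 5 → Fin 3 → ℝ) where
  toFun := eta5fun π
  map_add' := by
    intro v w; funext i j; simp [eta5fun, eta4fun, mul_add]
  map_smul' := by
    intro c v; funext i j; simp [eta5fun, eta4fun, smul_eq_mul]; ring

/-- Coefficient matrices of the ten characteristic functionals `r_λ`, `λ` an edge of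
`{1,…,5}` (0-indexed: rows `1,…,5` become `0,…,4`, columns `(a,b,c)` become `(0,1,2)`).
`rc p q` is the coefficient matrix of `r_{(p+1)(q+1)}` for `p < q`, and `0` otherwise. -/
def rc : Fin 5 → Fin 5 → Fin 5 → Fin 3 → ℝ :=
  -- r₁₂ = −a₃+a₄−a₅, r₁₃ = −a₂−b₄+b₅, r₁₄ = b₂−b₃−c₅, r₁₅ = −c₂+c₃−c₄,
  -- r₂₃ = −a₁+c₄−c₅, r₂₄ = b₁+c₃+b₅, r₂₅ = −c₁−b₃+b₄,
  -- r₃₄ = −c₁+c₂−a₅, r₃₅ = b₁−b₂−a₄, r₄₅ = −a₁+a₂−a₃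
  ![![0,
     ![![0,0,0], ![0,0,0], ![-1,0,0], ![1,0,0], ![-1,0,0]],
     ![![0,0,0], ![-1,0,0], ![0,0,0], ![0,-1,0], ![0,1,0]],
     ![![0,0,0], ![0,1,0], ![0,-1,0], ![0,0,0], ![0,0,-1]],
     ![![0,0,0], ![0,0,-1], ![0,0,1], ![0,0,-1], ![0,0,0]]],
    ![0, 0,
     ![![-1,0,0], ![0,0,0], ![0,0,0], ![0,0,1], ![0,0,-1]],
     ![![0,1,0], ![0,0,0], ![0,0,1], ![0,0,0], ![0,1,0]],
     ![![0,0,-1], ![0,0,0], ![0,-1,0], ![0,1,0], ![0,0,0]]],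
    ![0, 0, 0,
     ![![0,0,-1], ![0,0,1], ![0,0,0], ![0,0,0], ![-1,0,0]],
     ![![0,1,0], ![0,-1,0], ![0,0,0], ![-1,0,0], ![0,0,0]]],
    ![0, 0, 0, 0,
     ![![-1,0,0], ![1,0,0], ![-1,0,0], ![0,0,0], ![0,0,0]]],
    ![0, 0, 0, 0, 0]]

/-- The characteristic functional `r_λ : V⁵ → ℝ` for the edge `λ = {p,q}`, `p < q`. -/
def rfun (p q : Fin 5) (v : Fin 5 → Fin 3 → ℝ) : ℝ :=
  ∑ i, ∑ j, rc p q i j * v i j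

/-- The subspace `L₅ ⊂ V⁵` of `5 × 3` matrices whose rows sum to zero. -/
def L5sub : Submodule ℝ (Fin 5 → Fin 3 → ℝ) where
  carrier := {v | ∀ i, v i 0 + v i 1 + v i 2 = 0}
  zero_mem' := by intro i; simp
  add_mem' := by
    intro a b ha hb i
    have h1 := ha i; have h2 := hb i
    simp only [Pi.add_apply]; linarith
  smul_mem' := by
    intro c a ha i
    simp only [Pi.smul_apply, smul_eq_mul]
    linear_combination c * ha i

/-- The characteristic functional `r_λ` as a linear functional on `V⁵`. -/
def rlin (p q : Fin 5) : (Fin 5 → Fin 3 → ℝ) →ₗ[ℝ] ℝ where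
  toFun := fun v => ∑ i, ∑ j, rc p q i j * v i j
  map_add' := by
    intro v w
    rw [← Finset.sum_add_distrib]
    refine Finset.sum_congr rfl fun i _ => ?_
    rw [← Finset.sum_add_distrib]
    exact Finset.sum_congr rfl fun j _ => by simp [mul_add]
  map_smul' := by
    intro c v
    simp only [RingHom.id_apply, Pi.smul_apply, smul_eq_mul, Finset.mul_sum]
    exact Finset.sum_congr rfl fun i _ => Finset.sum_congr rfl fun j _ => by ring

/-- The symmetry set `R̂ = ⋂_{λ ∈ Λ} {v ∈ L₅ : r_λ(v) = 0}`, a subspace of `L₅`. -/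
def Rhat : Submodule ℝ (Fin 5 → Fin 3 → ℝ) :=
  L5sub ⊓ ⨅ (p : Fin 5), ⨅ (q : Fin 5), ⨅ (_ : p < q), LinearMap.ker (rlin p q)

/-- The orthogonal complement `R̂^⊥` of the symmetry set `R̂` within `L₅`, with respect to
the standard inner product `⟨v,w⟩ = Σ_{i,j} v_{ij} w_{ij}` of `V⁵`. -/
def Rperp : Submodule ℝ (Fin 5 → Fin 3 → ℝ) where
  carrier := {v | v ∈ L5sub ∧ ∀ w ∈ Rhat, ∑ i, ∑ j, v i j * w i j = 0}
  zero_mem' := ⟨L5sub.zero_mem, by intro w _; simp⟩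
  add_mem' := by
    rintro a b ⟨ha1, ha2⟩ ⟨hb1, hb2⟩
    refine ⟨L5sub.add_mem ha1 hb1, fun w hw => ?_⟩
    simp only [Pi.add_apply, add_mul, Finset.sum_add_distrib, ha2 w hw, hb2 w hw, add_zero]
  smul_mem' := by
    rintro c a ⟨ha1, ha2⟩
    refine ⟨L5sub.smul_mem c ha1, fun w hw => ?_⟩
    simp only [Pi.smul_apply, smul_eq_mul, mul_assoc, ← Finset.mul_sum, ha2 w hw, mul_zero]

/-- Integer model of `eta5fun`. -/
def etaZ (π : Equiv.Perm (Fin 5)) (v : Fin 5 → Fin 3 → ℤ) (i : Fin 5) (j : Fin 3) : ℤ :=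
  (Equiv.Perm.sign (inducedPerm π (π⁻¹ i)) : ℤ) *
    v (π⁻¹ i) ((phi (inducedPerm π (π⁻¹ i)))⁻¹ j)

/-- Entrywise cast of an integer matrix. -/
def castM (v : Fin 5 → Fin 3 → ℤ) : Fin 5 → Fin 3 → ℝ := fun i j => (v i j : ℝ)

lemma eta5lin_castM (π : Equiv.Perm (Fin 5)) (v : Fin 5 → Fin 3 → ℤ) :
    eta5lin π (castM v) = castM (etaZ π v) := by
  funext i j
  simp [eta5lin, eta5fun, eta4fun, castM, etaZ]

/-- Six times the reduced echelon basis of `Rperp`. -/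
def bZ : Fin 5 → Fin 5 → Fin 3 → ℤ :=
  ![![![6, 0, -6], ![0, 0, 0], ![0, -3, 3], ![2, 5, -7], ![-4, -1, 5]],
    ![![0, 6, -6], ![0, 0, 0], ![0, -6, 6], ![-2, 4, -2], ![-2, 4, -2]],
    ![![0, 0, 0], ![6, 0, -6], ![0, -3, 3], ![-2, 7, -5], ![4, -5, 1]],
    ![![0, 0, 0], ![0, 6, -6], ![0, -6, 6], ![2, 2, -4], ![2, 2, -4]],
    ![![0, 0, 0], ![0, 0, 0], ![6, -3, -3], ![-6, 3, 3], ![6, -3, -3]]]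

/-- Row and column of the pivot entries. -/
def pr : Fin 5 → Fin 5 := ![0, 0, 1, 1, 2]
def pc : Fin 5 → Fin 3 := ![0, 1, 0, 1, 0]

lemma etaZ_bZ : ∀ (n : Fin 4) (k : Fin 5) (i : Fin 5) (j : Fin 3),
    6 * etaZ (swap n.castSucc n.succ) (bZ k) i j =
      ∑ l, etaZ (swap n.castSucc n.succ) (bZ k) (pr l) (pc l) * bZ l i j := by
  decide +kernel

lemma phi_mul : ∀ (π σ : Equiv.Perm (Fin 4)), phi (π * σ) = phi π * phi σ := by
  have h : ∀ (π σ : Equiv.Perm (Fin 4)) (j : Fin 3),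
      phiFun (π * σ) j = phiFun π (phiFun σ j) := by decide +kernel
  intro π σ
  ext1 j
  exact h π σ j

lemma inducedPerm_mul (π σ : Equiv.Perm (Fin 5)) (i : Fin 5) :
    inducedPerm (π * σ) i = inducedPerm π (σ i) * inducedPerm σ i := by
  ext1 x
  simp [inducedPerm, restrictPerm]

lemma eta5lin_mul (π σ : Equiv.Perm (Fin 5)) (v : Fin 5 → Fin 3 → ℝ) :
    eta5lin (π * σ) v = eta5lin π (eta5lin σ v) := by
  have h : ∀ y, σ (σ⁻¹ y) = y := σ.apply_symm_apply
  funext i j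
  simp only [eta5lin, LinearMap.coe_mk, AddHom.coe_mk, eta5fun, eta4fun, inducedPerm_mul,
    phi_mul, mul_inv_rev, Equiv.Perm.mul_apply, Equiv.Perm.sign_mul, h]
  push_cast
  ring

lemma eta5lin_one (v : Fin 5 → Fin 3 → ℝ) : eta5lin 1 v = v := by
  have h : ∀ i, inducedPerm (1 : Equiv.Perm (Fin 5)) i = 1 := by
    intro i
    ext1 x
    simp [inducedPerm, restrictPerm]
  have h2 : phi 1 = 1 := by decide
  funext i j
  simp [eta5lin, eta5fun, eta4fun, h, h2]

lemma traceZ : ∀ a b : Fin 5, a ≠ b →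
    ∑ k, etaZ (Equiv.swap a b) (bZ k) (pr k) (pc k) = -6 := by
  decide +kernel

/-- The stabiliser of the edge `{0,1}`. -/
def stab : Fin 12 → Equiv.Perm (Fin 5) :=
  ![1, swap 3 4, swap 2 3, swap 2 4, swap 2 3 * swap 3 4, swap 3 4 * swap 2 3,
    swap 0 1, swap 0 1 * swap 3 4, swap 0 1 * swap 2 3, swap 0 1 * swap 2 4,
    swap 0 1 * (swap 2 3 * swap 3 4), swap 0 1 * (swap 3 4 * swap 2 3)]

/-- The signs of the elements of the stabiliser. -/
def ssgn : Fin 12 → ℤ := ![1, -1, -1, -1, 1, 1, -1, 1, 1, 1, -1, -1]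

lemma projZ : ∀ (m : Fin 5) (i : Fin 5) (j : Fin 3),
    3 * ∑ h, ssgn h * etaZ (stab h) (bZ m) i j =
      2 * (- bZ m 0 0 + bZ m 1 0 + 3 * bZ m 2 0) * bZ 4 i j := by
  decide +kernel

lemma genZ : ∀ (i : Fin 5) (j : Fin 3),
    3 * bZ 0 i j = bZ 4 i j - 4 * etaZ (swap 0 2) (bZ 4) i j - 2 * etaZ (swap 0 3) (bZ 4) i j ∧
    3 * bZ 1 i j = 2 * bZ 4 i j - 2 * etaZ (swap 0 2) (bZ 4) i j
      - 4 * etaZ (swap 0 3) (bZ 4) i j ∧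
    3 * bZ 2 i j = - bZ 4 i j + 4 * etaZ (swap 1 2) (bZ 4) i j
      + 2 * etaZ (swap 1 3) (bZ 4) i j ∧
    3 * bZ 3 i j = - 2 * bZ 4 i j + 2 * etaZ (swap 1 2) (bZ 4) i j
      + 4 * etaZ (swap 1 3) (bZ 4) i j := by
  decide +kernel

/-- The values of the functional on the transforms of the basis. -/
lemma funcZ : ∀ m : Fin 5,
    (- etaZ (swap 0 2) (bZ m) 0 0 + etaZ (swap 0 2) (bZ m) 1 0 + 3 * etaZ (swap 0 2) (bZ m) 2 0
      = ![-18, 0, -6, 0, 6] m) ∧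
    (- etaZ (swap 0 3) (bZ m) 0 0 + etaZ (swap 0 3) (bZ m) 1 0 + 3 * etaZ (swap 0 3) (bZ m) 2 0
      = ![-2, -16, 2, -8, 6] m) ∧
    (- etaZ (swap 1 2) (bZ m) 0 0 + etaZ (swap 1 2) (bZ m) 1 0 + 3 * etaZ (swap 1 2) (bZ m) 2 0
      = ![6, 0, 18, 0, 6] m) ∧
    (- etaZ (swap 1 3) (bZ m) 0 0 + etaZ (swap 1 3) (bZ m) 1 0 + 3 * etaZ (swap 1 3) (bZ m) 2 0
      = ![-2, 8, 2, 16, 6] m) := by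
  decide +kernel

lemma mem_Rhat_iff (w : Fin 5 → Fin 3 → ℝ) :
    w ∈ Rhat ↔ w ∈ L5sub ∧ ∀ p q : Fin 5, p < q → rlin p q w = 0 := by
  simp [Rhat, Submodule.mem_iInf]

lemma castM_bZ_mem (k : Fin 5) : castM (bZ k) ∈ Rperp := by
  refine ⟨?_, ?_⟩
  · have h : ∀ k i, bZ k i 0 + bZ k i 1 + bZ k i 2 = 0 := by decide
    intro i
    have := h k i
    simp only [castM]
    exact_mod_cast this
  · intro w hw
    rw [mem_Rhat_iff] at hw
    obtain ⟨-, hr⟩ := hw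
    have h01 := hr 0 1 (by decide)
    have h02 := hr 0 2 (by decide)
    have h03 := hr 0 3 (by decide)
    have h04 := hr 0 4 (by decide)
    have h12 := hr 1 2 (by decide)
    have h13 := hr 1 3 (by decide)
    have h14 := hr 1 4 (by decide)
    have h23 := hr 2 3 (by decide)
    have h24 := hr 2 4 (by decide)
    have h34 := hr 3 4 (by decide)
    simp [rlin, rc, Fin.sum_univ_succ] at h01 h02 h03 h04 h12 h13 h14 h23 h24 h34
    fin_cases k <;> simp [castM, bZ, Fin.sum_univ_succ] <;> linarith

/-- A spanning set of `Rhat`. -/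
def wZ : Fin 5 → Fin 5 → Fin 3 → ℤ :=
  ![![![0, -1, 1], ![0, -1, 1], ![0, -1, 1], ![0, 0, 0], ![0, 0, 0]],
    ![![0, 0, 0], ![-1, 1, 0], ![-1, 1, 0], ![-1, 1, 0], ![0, 0, 0]],
    ![![1, 0, -1], ![0, 1, -1], ![-1, 1, 0], ![-1, 0, 1], ![0, 0, 0]],
    ![![0, -1, 1], ![1, -1, 0], ![1, -1, 0], ![0, 0, 0], ![-1, 1, 0]],
    ![![-1, 0, 1], ![0, 0, 0], ![1, -1, 0], ![0, 0, 0], ![-1, 0, 1]]]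

lemma castM_wZ_mem (k : Fin 5) : castM (wZ k) ∈ Rhat := by
  rw [mem_Rhat_iff]
  refine ⟨?_, ?_⟩
  · have h : ∀ k i, wZ k i 0 + wZ k i 1 + wZ k i 2 = 0 := by decide
    intro i
    have := h k i
    simp only [castM]
    exact_mod_cast this
  · intro p q hpq
    fin_cases p <;> fin_cases q <;> first | (exact absurd hpq (by decide)) | skip
    all_goals
      fin_cases k <;> simp [rlin, rc, castM, wZ, Fin.sum_univ_succ]

lemma Rperp_eq (v : Fin 5 → Fin 3 → ℝ) (hv : v ∈ Rperp) :
    v = ∑ k, (v (pr k) (pc k) / 6) • castM (bZ k) := by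
  obtain ⟨hL, ho⟩ := hv
  have l0 := hL 0
  have l1 := hL 1
  have l2 := hL 2
  have l3 := hL 3
  have l4 := hL 4
  have o0 := ho _ (castM_wZ_mem 0)
  have o1 := ho _ (castM_wZ_mem 1)
  have o2 := ho _ (castM_wZ_mem 2)
  have o3 := ho _ (castM_wZ_mem 3)
  have o4 := ho _ (castM_wZ_mem 4)
  simp [castM, wZ, Fin.sum_univ_succ] at o0 o1 o2 o3 o4
  funext i j
  fin_cases i <;> fin_cases j <;>
    simp [castM, bZ, pr, pc, Fin.sum_univ_succ] <;> linarith

lemma castM_eta_mem (n : Fin 4) (k : Fin 5) :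
    eta5lin (swap n.castSucc n.succ) (castM (bZ k)) ∈ Rperp := by
  rw [eta5lin_castM]
  have h : castM (etaZ (swap n.castSucc n.succ) (bZ k)) =
      ∑ l, ((etaZ (swap n.castSucc n.succ) (bZ k) (pr l) (pc l) : ℝ) / 6) • castM (bZ l) := by
    funext i j
    have := etaZ_bZ n k i j
    have h2 : (6 : ℝ) * etaZ (swap n.castSucc n.succ) (bZ k) i j =
        ∑ l, (etaZ (swap n.castSucc n.succ) (bZ k) (pr l) (pc l) : ℝ) * bZ l i j := by exact_mod_cast this
    simp only [Finset.sum_apply, Pi.smul_apply, smul_eq_mul, castM, div_mul_eq_mul_div,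
      ← Finset.sum_div]
    linarith
  rw [h]
  exact Submodule.sum_mem _ fun l _ => Submodule.smul_mem _ _ (castM_bZ_mem l)

lemma eta_swap_mem (n : Fin 4) (v : Fin 5 → Fin 3 → ℝ) (hv : v ∈ Rperp) :
    eta5lin (swap n.castSucc n.succ) v ∈ Rperp := by
  rw [Rperp_eq v hv, map_sum]
  refine Submodule.sum_mem _ fun k _ => ?_
  rw [map_smul]
  exact Submodule.smul_mem _ _ (castM_eta_mem n k)

lemma eta_mem (π : Equiv.Perm (Fin 5)) : ∀ v ∈ Rperp, eta5lin π v ∈ Rperp := by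
  have hπ : π ∈ Submonoid.closure
      (Set.range fun n : Fin 4 => swap n.castSucc n.succ) := by
    rw [Equiv.Perm.mclosure_swap_castSucc_succ]
    trivial
  induction hπ using Submonoid.closure_induction with
  | mem x hx =>
    obtain ⟨n, rfl⟩ := hx
    exact eta_swap_mem n
  | one => intro v hv; rwa [eta5lin_one]
  | mul x y _ _ hx hy => intro v hv; rw [eta5lin_mul]; exact hx _ (hy _ hv)

lemma bZ_piv : ∀ k l : Fin 5, bZ k (pr l) (pc l) = if k = l then 6 else 0 := by decide

/-- Pivot coordinates on `Rperp`. -/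
noncomputable def coordEquiv : Rperp ≃ₗ[ℝ] (Fin 5 → ℝ) where
  toFun v := fun k => v.1 (pr k) (pc k)
  map_add' _ _ := rfl
  map_smul' _ _ := rfl
  invFun y := ⟨∑ k, (y k / 6) • castM (bZ k),
    Submodule.sum_mem _ fun l _ => Submodule.smul_mem _ _ (castM_bZ_mem l)⟩
  left_inv v := Subtype.ext (Rperp_eq v.1 v.2).symm
  right_inv y := by
    funext l
    simp [castM, bZ_piv]

/-- The linear functional cutting out the projection to the line of `bZ 4`. -/
def fl (v : Fin 5 → Fin 3 → ℝ) : ℝ := - v 0 0 + v 1 0 + 3 * v 2 0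

lemma proj_bZ (m : Fin 5) :
    ∑ h, (ssgn h : ℝ) • eta5lin (stab h) (castM (bZ m)) =
      (2 / 3 * fl (castM (bZ m))) • castM (bZ 4) := by
  funext i j
  have h := projZ m i j
  have h2 : (3 : ℝ) * ∑ h, (ssgn h : ℝ) * (etaZ (stab h) (bZ m) i j : ℝ) =
      2 * (- (bZ m 0 0 : ℝ) + bZ m 1 0 + 3 * bZ m 2 0) * bZ 4 i j := by exact_mod_cast h
  simp only [eta5lin_castM, Finset.sum_apply, Pi.smul_apply, smul_eq_mul]
  simp only [castM, fl]
  linarith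

lemma fl_sum (y : Fin 5 → ℝ) (u : Fin 5 → Fin 5 → Fin 3 → ℝ) :
    fl (∑ k, y k • u k) = ∑ k, y k * fl (u k) := by
  simp only [fl, Finset.sum_apply, Pi.smul_apply, smul_eq_mul, Fin.sum_univ_five]
  ring

lemma proj_mem (v : Fin 5 → Fin 3 → ℝ) (hv : v ∈ Rperp) :
    ∑ h, (ssgn h : ℝ) • eta5lin (stab h) v =
      (2 / 3 * fl v) • castM (bZ 4) := by
  have e := Rperp_eq v hv
  set x : Fin 5 → ℝ := fun k => v (pr k) (pc k) / 6 with hx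
  change v = ∑ k, x k • castM (bZ k) at e
  clear_value x
  subst e
  rw [fl_sum]
  simp only [map_sum, map_smul, Finset.smul_sum]
  rw [Finset.sum_comm]
  rw [Finset.mul_sum, Finset.sum_smul]
  refine Finset.sum_congr rfl fun k _ => ?_
  simp only [smul_comm _ (x k)]
  rw [← Finset.smul_sum, proj_bZ, smul_smul]
  congr 1
  ring

lemma eq_zero_of_fl (v : Fin 5 → Fin 3 → ℝ) (hv : v ∈ Rperp)
    (h0 : fl v = 0) (h1 : fl (eta5lin (swap 0 2) v) = 0) (h2 : fl (eta5lin (swap 0 3) v) = 0)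
    (h3 : fl (eta5lin (swap 1 2) v) = 0) (h4 : fl (eta5lin (swap 1 3) v) = 0) : v = 0 := by
  have e := Rperp_eq v hv
  set x : Fin 5 → ℝ := fun k => v (pr k) (pc k) / 6 with hx
  change v = ∑ k, x k • castM (bZ k) at e
  clear_value x
  subst e
  have g1 : ∀ m, fl (castM (etaZ (swap 0 2) (bZ m))) = ((![-18, 0, -6, 0, 6] m : ℤ) : ℝ) := by
    intro m; rw [← (funcZ m).1]; simp [fl, castM]
  have g2 : ∀ m, fl (castM (etaZ (swap 0 3) (bZ m))) = ((![-2, -16, 2, -8, 6] m : ℤ) : ℝ) := by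
    intro m; rw [← (funcZ m).2.1]; simp [fl, castM]
  have g3 : ∀ m, fl (castM (etaZ (swap 1 2) (bZ m))) = ((![6, 0, 18, 0, 6] m : ℤ) : ℝ) := by
    intro m; rw [← (funcZ m).2.2.1]; simp [fl, castM]
  have g4 : ∀ m, fl (castM (etaZ (swap 1 3) (bZ m))) = ((![-2, 8, 2, 16, 6] m : ℤ) : ℝ) := by
    intro m; rw [← (funcZ m).2.2.2]; simp [fl, castM]
  simp only [map_sum, map_smul, eta5lin_castM, fl_sum, g1, g2, g3, g4] at h0 h1 h2 h3 h4
  simp [Fin.sum_univ_five, fl, castM, bZ] at h0 h1 h2 h3 h4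
  have z0 : x 0 = 0 := by linarith
  have z1 : x 1 = 0 := by linarith
  have z2 : x 2 = 0 := by linarith
  have z3 : x 3 = 0 := by linarith
  have z4 : x 4 = 0 := by linarith
  simp [Fin.sum_univ_five, z0, z1, z2, z3, z4]

lemma irred (W : Submodule ℝ (Fin 5 → Fin 3 → ℝ)) (hW : W ≤ Rperp)
    (hinv : ∀ π : Equiv.Perm (Fin 5), ∀ v ∈ W, eta5lin π v ∈ W) : W = ⊥ ∨ W = Rperp := by
  have key : ∀ v ∈ W, fl v ≠ 0 → castM (bZ 4) ∈ W := by
    intro v hv hf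
    have hp : ∑ h, (ssgn h : ℝ) • eta5lin (stab h) v ∈ W :=
      Submodule.sum_mem _ fun h _ => Submodule.smul_mem _ _ (hinv (stab h) v hv)
    rw [proj_mem v (hW hv)] at hp
    exact (Submodule.smul_mem_iff _ (mul_ne_zero (by norm_num) hf)).1 hp
  by_cases h4 : castM (bZ 4) ∈ W
  · right
    refine le_antisymm hW fun v hv => ?_
    have a1 := hinv (swap 0 2) _ h4
    have a2 := hinv (swap 0 3) _ h4
    have a3 := hinv (swap 1 2) _ h4
    have a4 := hinv (swap 1 3) _ h4
    rw [eta5lin_castM] at a1 a2 a3 a4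
    have comb : ∀ (k : Fin 5) (a b c : ℤ) (s t : Fin 5 → Fin 3 → ℤ), castM s ∈ W → castM t ∈ W →
        (∀ i j, 3 * bZ k i j = a * bZ 4 i j + b * s i j + c * t i j) → castM (bZ k) ∈ W := by
      intro k a b c s t hs ht h
      have e : castM (bZ k) = ((a : ℝ) / 3) • castM (bZ 4) + ((b : ℝ) / 3) • castM s
          + ((c : ℝ) / 3) • castM t := by
        funext i j
        have h2 : (3 : ℝ) * bZ k i j = a * bZ 4 i j + b * s i j + c * t i j := by
          exact_mod_cast h i j
        simp only [castM, Pi.add_apply, Pi.smul_apply, smul_eq_mul]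
        linarith
      rw [e]
      exact W.add_mem (W.add_mem (W.smul_mem _ h4) (W.smul_mem _ hs)) (W.smul_mem _ ht)
    have hb : ∀ k, castM (bZ k) ∈ W := by
      intro k
      fin_cases k
      · exact comb 0 1 (-4) (-2) _ _ a1 a2 fun i j => by linarith [(genZ i j).1]
      · exact comb 1 2 (-2) (-4) _ _ a1 a2 fun i j => by linarith [(genZ i j).2.1]
      · exact comb 2 (-1) 4 2 _ _ a3 a4 fun i j => by linarith [(genZ i j).2.2.1]
      · exact comb 3 (-2) 2 4 _ _ a3 a4 fun i j => by linarith [(genZ i j).2.2.2]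
      · exact h4
    rw [Rperp_eq v hv]
    exact W.sum_mem fun k _ => W.smul_mem _ (hb k)
  · left
    rw [Submodule.eq_bot_iff]
    intro v hv
    have z : ∀ u ∈ W, fl u = 0 := fun u hu => by
      by_contra hne
      exact h4 (key u hu hne)
    exact eq_zero_of_fl v (hW hv) (z _ hv) (z _ (hinv _ _ hv)) (z _ (hinv _ _ hv))
      (z _ (hinv _ _ hv)) (z _ (hinv _ _ hv))

lemma trace_swap (π : Equiv.Perm (Fin 5)) (hπ : π.cycleType = {2})
    (h : ∀ v ∈ Rperp, eta5lin π v ∈ Rperp) :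
    LinearMap.trace ℝ Rperp ((eta5lin π).restrict h) = -1 := by
  obtain ⟨a, b, hab, rfl⟩ := Equiv.Perm.isSwap_iff_cycleType.2 hπ
  rw [LinearMap.trace_eq_matrix_trace ℝ (Module.Basis.ofEquivFun coordEquiv)]
  have hk : ∀ k, LinearMap.toMatrix (Module.Basis.ofEquivFun coordEquiv)
      (Module.Basis.ofEquivFun coordEquiv) ((eta5lin (swap a b)).restrict h) k k =
      (etaZ (swap a b) (bZ k) (pr k) (pc k) : ℝ) / 6 := by
    intro k
    have e : ((Module.Basis.ofEquivFun coordEquiv k : Rperp) : Fin 5 → Fin 3 → ℝ) =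
        (1 / 6 : ℝ) • castM (bZ k) := by
      rw [Module.Basis.coe_ofEquivFun]
      change ∑ l, ((Pi.single k (1 : ℝ) : Fin 5 → ℝ) l / 6) • castM (bZ l) = _
      rw [Finset.sum_eq_single k]
      · simp
      · intro l _ hl; simp [hl]
      · simp
    rw [LinearMap.toMatrix_apply, ← Module.Basis.equivFun_apply, Module.Basis.equivFun_ofEquivFun]
    change eta5lin (swap a b) (Module.Basis.ofEquivFun coordEquiv k : Rperp).1 (pr k) (pc k) = _
    rw [e, map_smul, eta5lin_castM]
    simp only [Pi.smul_apply, smul_eq_mul, castM]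
    ring
  simp only [Matrix.trace, Matrix.diag_apply, hk]
  rw [← Finset.sum_div]
  have := traceZ a b hab
  have h2 : ∑ k, (etaZ (swap a b) (bZ k) (pr k) (pc k) : ℝ) = -6 := by exact_mod_cast this
  rw [h2]
  norm_num

/-- Proposition 5.3 (part): the orthogonal complement `R̂^⊥` of `R̂` within `L₅` is an
`η₅`-invariant 5-dimensional subspace, the restriction of `η₅` to it is irreducible, and
its trace on every transposition equals `−1`; hence the character of `η₅|R̂^⊥` is the
prime character `χ^{2²1}`. -/
theorem Rperp_irreducible_chi221 :
    (∀ π : Equiv.Perm (Fin 5), ∀ v ∈ Rperp, eta5lin π v ∈ Rperp) ∧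
    Module.finrank ℝ Rperp = 5 ∧
    (∀ W : Submodule ℝ (Fin 5 → Fin 3 → ℝ), W ≤ Rperp →
      (∀ π : Equiv.Perm (Fin 5), ∀ v ∈ W, eta5lin π v ∈ W) → W = ⊥ ∨ W = Rperp) ∧
    (∀ π : Equiv.Perm (Fin 5), π.cycleType = {2} →
      ∀ h : ∀ v ∈ Rperp, eta5lin π v ∈ Rperp,
        LinearMap.trace ℝ Rperp ((eta5lin π).restrict h) = -1) := by
  refine ⟨eta_mem, ?_, irred, trace_swap⟩
  rw [coordEquiv.finrank_eq]
  simp
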